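/- Under the multiplex RWM recursion, for all indices i, j the sequence of relevance weights t ↦ W^{(t)}(i,j) is nondecreasing in t, satisfies 0 ≤ W^{(t)}(i,j) ≤ 1/(1−λ) for all t, each row sum satisfies 1 ≤ Σ_{k=1}^K W^{(t)}(i,k) ≤ K/(1−λ) for all t, and the limit lim_{t→∞} W^{(t)}(i,j) exists. -/

import Mathlib

open Finset Filter Matrix Topology

/-- Cosine similarity of two vectors in `ℝ^n` (0 when a denominator vanishes,
since division by zero is 0 in Lean). -/
noncomputable def cosSim {n : ℕ} (u v : Fin n → ℝ) : ℝ :=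
  (∑ k, u k * v k) / (Real.sqrt (∑ k, u k * u k) * Real.sqrt (∑ k, v k * v k))

/-- The maximum of the absolute values of the entries of a real matrix. -/
noncomputable def matInfNorm {m n : ℕ} (M : Matrix (Fin m) (Fin n) ℝ) : ℝ :=
  ⨆ p : Fin m × Fin n, |M p.1 p.2|

/-- The joint state `(W^{(t)}, x^{(t)})` of the multiplex RWM recursion:
`W^{(0)} = I`, `x^{(0)}` given; `Ŵ^{(t)}(i,j) = W^{(t)}(i,j)/∑_k W^{(t)}(i,k)`,
`𝒫_i^{(t)} = ∑_j Ŵ^{(t)}(i,j) P_j`, `x_i^{(t+1)} = 𝒫_i^{(t)} x_i^{(t)}`, and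
`W^{(t+1)}(i,j) = W^{(t)}(i,j) + λ^{t+1} cos(x_i^{(t+1)}, x_j^{(t+1)})`. -/
noncomputable def rwmState {K n : ℕ} (lam : ℝ) (P : Fin K → Matrix (Fin n) (Fin n) ℝ)
    (x0 : Fin K → Fin n → ℝ) : ℕ → Matrix (Fin K) (Fin K) ℝ × (Fin K → Fin n → ℝ)
  | 0 => (1, x0)
  | t + 1 =>
      let Wt := (rwmState lam P x0 t).1
      let xt := (rwmState lam P x0 t).2
      let What : Matrix (Fin K) (Fin K) ℝ := Matrix.of fun i j => Wt i j / ∑ k, Wt i k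
      let Pmod : Fin K → Matrix (Fin n) (Fin n) ℝ := fun i => ∑ j, What i j • P j
      let xNew : Fin K → Fin n → ℝ := fun i => (Pmod i).mulVec (xt i)
      (Matrix.of fun i j => Wt i j + lam ^ (t + 1) * cosSim (xNew i) (xNew j), xNew)

/-- The relevance weight matrix `W^{(t)}`. -/
noncomputable def rwmW {K n : ℕ} (lam : ℝ) (P : Fin K → Matrix (Fin n) (Fin n) ℝ)
    (x0 : Fin K → Fin n → ℝ) (t : ℕ) : Matrix (Fin K) (Fin K) ℝ :=
  (rwmState lam P x0 t).1

/-- The visiting probability vector `x_i^{(t)}`. -/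
noncomputable def rwmX {K n : ℕ} (lam : ℝ) (P : Fin K → Matrix (Fin n) (Fin n) ℝ)
    (x0 : Fin K → Fin n → ℝ) (t : ℕ) (i : Fin K) : Fin n → ℝ :=
  (rwmState lam P x0 t).2 i

/-- The row-normalized relevance weight matrix `Ŵ^{(t)}`. -/
noncomputable def rwmWhat {K n : ℕ} (lam : ℝ) (P : Fin K → Matrix (Fin n) (Fin n) ℝ)
    (x0 : Fin K → Fin n → ℝ) (t : ℕ) : Matrix (Fin K) (Fin K) ℝ :=
  Matrix.of fun i j => rwmW lam P x0 t i j / ∑ k, rwmW lam P x0 t i k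

/-- The modified transition matrix `𝒫_i^{(t)} = ∑_j Ŵ^{(t)}(i,j) P_j`. -/
noncomputable def rwmPmod {K n : ℕ} (lam : ℝ) (P : Fin K → Matrix (Fin n) (Fin n) ℝ)
    (x0 : Fin K → Fin n → ℝ) (t : ℕ) (i : Fin K) : Matrix (Fin n) (Fin n) ℝ :=
  ∑ j, rwmWhat lam P x0 t i j • P j

theorem cosSim_nonneg {n : ℕ} {u v : Fin n → ℝ} (hu : ∀ k, 0 ≤ u k) (hv : ∀ k, 0 ≤ v k) :
    0 ≤ cosSim u v :=
  div_nonneg (sum_nonneg fun k _ => mul_nonneg (hu k) (hv k)) (by positivity)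

theorem cosSim_le_one {n : ℕ} (u v : Fin n → ℝ) : cosSim u v ≤ 1 := by
  refine div_le_one_of_le₀ ?_ (by positivity)
  simpa only [sq] using Real.sum_mul_le_sqrt_mul_sqrt univ u v

section

variable {K n : ℕ} {lam : ℝ} {P : Fin K → Matrix (Fin n) (Fin n) ℝ} {x0 : Fin K → Fin n → ℝ}

theorem rwmW_zero : rwmW lam P x0 0 = 1 := rfl

theorem rwmW_succ (t : ℕ) (i j : Fin K) :
    rwmW lam P x0 (t + 1) i j = rwmW lam P x0 t i j +
      lam ^ (t + 1) * cosSim (rwmX lam P x0 (t + 1) i) (rwmX lam P x0 (t + 1) j) := rfl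

theorem rwmX_succ (t : ℕ) (i : Fin K) :
    rwmX lam P x0 (t + 1) i = (rwmPmod lam P x0 t i).mulVec (rwmX lam P x0 t i) := rfl

theorem rwmPmod_nonneg (hP : ∀ j v u, 0 ≤ P j v u) {t : ℕ}
    (hW : ∀ i j, 0 ≤ rwmW lam P x0 t i j) (i : Fin K) (v u : Fin n) :
    0 ≤ rwmPmod lam P x0 t i v u := by
  rw [rwmPmod, Matrix.sum_apply]
  exact sum_nonneg fun j _ =>
    mul_nonneg (div_nonneg (hW i j) (sum_nonneg fun k _ => hW i k)) (hP j v u)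

theorem rwmW_nonneg_and_rwmX_nonneg (hlam : 0 ≤ lam) (hP : ∀ j v u, 0 ≤ P j v u)
    (hx0 : ∀ i v, 0 ≤ x0 i v) (t : ℕ) :
    (∀ i j, 0 ≤ rwmW lam P x0 t i j) ∧ ∀ i v, 0 ≤ rwmX lam P x0 t i v := by
  induction t with
  | zero =>
    refine ⟨fun i j => ?_, hx0⟩
    rw [rwmW_zero, Matrix.one_apply]
    split_ifs <;> norm_num
  | succ t ih =>
    have hX : ∀ i v, 0 ≤ rwmX lam P x0 (t + 1) i v := fun i v => by
      rw [rwmX_succ, Matrix.mulVec, dotProduct]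
      exact sum_nonneg fun u _ => mul_nonneg (rwmPmod_nonneg hP ih.1 i v u) (ih.2 i u)
    refine ⟨fun i j => ?_, hX⟩
    rw [rwmW_succ]
    exact add_nonneg (ih.1 i j) (mul_nonneg (pow_nonneg hlam _) (cosSim_nonneg (hX i) (hX j)))

theorem rwmW_monotone (hlam : 0 ≤ lam) (hP : ∀ j v u, 0 ≤ P j v u)
    (hx0 : ∀ i v, 0 ≤ x0 i v) (i j : Fin K) : Monotone fun t => rwmW lam P x0 t i j := by
  refine monotone_nat_of_le_succ fun t => ?_
  have hX := (rwmW_nonneg_and_rwmX_nonneg hlam hP hx0 (t + 1)).2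
  rw [rwmW_succ]
  exact le_add_of_nonneg_right (mul_nonneg (pow_nonneg hlam _) (cosSim_nonneg (hX i) (hX j)))

theorem rwmW_le_geom_sum (hlam : 0 ≤ lam) (t : ℕ) (i j : Fin K) :
    rwmW lam P x0 t i j ≤ ∑ s ∈ range (t + 1), lam ^ s := by
  induction t with
  | zero =>
    rw [rwmW_zero, Matrix.one_apply]
    split_ifs <;> simp
  | succ t ih =>
    rw [rwmW_succ, sum_range_succ]
    exact add_le_add ih (mul_le_of_le_one_right (pow_nonneg hlam _) (cosSim_le_one _ _))

theorem rwmW_le (hlam0 : 0 ≤ lam) (hlam1 : lam < 1) (t : ℕ) (i j : Fin K) :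
    rwmW lam P x0 t i j ≤ 1 / (1 - lam) := by
  refine (rwmW_le_geom_sum hlam0 t i j).trans ?_
  rw [one_div, ← tsum_geometric_of_lt_one hlam0 hlam1]
  exact (summable_geometric_of_lt_one hlam0 hlam1).sum_le_tsum _ fun s _ => pow_nonneg hlam0 s

end

/-- Under the multiplex RWM recursion, for all indices `i, j` the relevance weights
`t ↦ W^{(t)}(i,j)` are nondecreasing, satisfy `0 ≤ W^{(t)}(i,j) ≤ 1/(1−λ)`, each row
sum lies in `[1, K/(1−λ)]`, and `lim_{t→∞} W^{(t)}(i,j)` exists. -/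
theorem rwm_multiplex_weights_monotone_bounded_convergent
    (K n : ℕ) (hK : 1 ≤ K) (hn : 1 ≤ n)
    (lam : ℝ) (hlam0 : 0 < lam) (hlam1 : lam < 1)
    (P : Fin K → Matrix (Fin n) (Fin n) ℝ)
    (hPnn : ∀ j v u, 0 ≤ P j v u) (hPcol : ∀ j u, ∑ v, P j v u = 1)
    (x0 : Fin K → Fin n → ℝ)
    (hx0nn : ∀ i v, 0 ≤ x0 i v) (hx0sum : ∀ i, ∑ v, x0 i v = 1) :
    ∀ (i j : Fin K),
      (Monotone fun t => rwmW lam P x0 t i j) ∧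
      (∀ t : ℕ, 0 ≤ rwmW lam P x0 t i j ∧ rwmW lam P x0 t i j ≤ 1 / (1 - lam)) ∧
      (∀ t : ℕ, 1 ≤ ∑ k, rwmW lam P x0 t i k ∧ ∑ k, rwmW lam P x0 t i k ≤ K / (1 - lam)) ∧
      (∃ L : ℝ, Tendsto (fun t => rwmW lam P x0 t i j) atTop (𝓝 L)) := by
  intro i j
  have hmono := rwmW_monotone hlam0.le hPnn hx0nn i
  have hle := rwmW_le (P := P) (x0 := x0) hlam0.le hlam1
  refine ⟨hmono j, fun t => ⟨(rwmW_nonneg_and_rwmX_nonneg hlam0.le hPnn hx0nn t).1 i j,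
    hle t i j⟩, fun t => ⟨?_, ?_⟩, ?_⟩
  · calc (1 : ℝ) = ∑ k, rwmW lam P x0 0 i k := by simp [rwmW_zero, Matrix.one_apply]
      _ ≤ ∑ k, rwmW lam P x0 t i k := sum_le_sum fun k _ => hmono k t.zero_le
  · calc ∑ k, rwmW lam P x0 t i k ≤ ∑ _k : Fin K, 1 / (1 - lam) :=
          sum_le_sum fun k _ => hle t i k
      _ = K / (1 - lam) := by simp [div_eq_mul_inv]
  · exact ⟨_, tendsto_atTop_ciSup (hmono j) ⟨1 / (1 - lam), by rintro _ ⟨t, rfl⟩; exact hle t i j⟩⟩
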